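/- arXiv:0711.2552 — 2 statements merged into one kernel-verified Lean document; each statement's English description precedes it below -/
import Mathlib

section
/- Let m ∈ ℝ, r₀ > 0, and let A, V : [r₀, ∞) → ℝ be continuously differentiable functions satisfying A'(r) = A(r)/r + 4πr − 8πm + (2/r)(V'(r) − A(r)) + E(r), where E(r) → 0 as r → ∞. Then V(r) = (1/2) r A(r) − (2π/3) r³ + 2π m r² + o(r²) as r → ∞. -/
open Filter Real Topology

/-- If `g' (r) = r * e r` for large `r` with `e → 0` at infinity, then `g r / r ^ 2 → 0`. -/
theorem tendsto_div_sq_atTop_of_hasDerivAt {g e : ℝ → ℝ}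
    (hg : ∀ᶠ r in atTop, HasDerivAt g (r * e r) r) (he : Tendsto e atTop (𝓝 0)) :
    Tendsto (fun r => g r / r ^ 2) atTop (𝓝 0) := by
  rw [Metric.tendsto_nhds]
  intro ε hε
  have he' : ∀ᶠ r in atTop, |e r| < ε := by
    simpa [Real.dist_eq] using Metric.tendsto_nhds.1 he ε hε
  obtain ⟨R, hR⟩ := eventually_atTop.1 (hg.and (he'.and (eventually_gt_atTop 0)))
  have bound : ∀ x, R ≤ x → |g x| ≤ |g R| + ε / 2 * x ^ 2 := by
    intro x hx
    have hB : ∀ y : ℝ, HasDerivAt (fun y => |g R| + ε / 2 * y ^ 2) (ε * y) y := by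
      intro y
      refine (((hasDerivAt_pow 2 y).const_mul (ε / 2)).const_add |g R|).congr_deriv ?_
      push_cast
      ring
    refine image_norm_le_of_norm_deriv_right_le_deriv_boundary (f := g)
      (f' := fun r => r * e r) (a := R) (b := x)
      (fun y hy => (hR y hy.1).1.continuousAt.continuousWithinAt)
      (fun y hy => (hR y hy.1).1.hasDerivWithinAt) ?_ hB ?_ ⟨hx, le_rfl⟩
    · rw [Real.norm_eq_abs]
      have : 0 ≤ ε / 2 * R ^ 2 := by positivity
      linarith
    · intro y hy
      obtain ⟨-, h1, h2⟩ := hR y hy.1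
      rw [Real.norm_eq_abs, abs_mul, abs_of_pos h2, mul_comm]
      gcongr
  have hsq : ∀ᶠ r : ℝ in atTop, 2 * |g R| / ε < r ^ 2 :=
    (tendsto_pow_atTop two_ne_zero).eventually_gt_atTop _
  filter_upwards [hsq, eventually_ge_atTop R] with r hr hRr
  have hr0 : 0 < r ^ 2 := pow_pos (hR r hRr).2.2 2
  rw [Real.dist_eq, sub_zero, abs_div, abs_of_pos hr0, div_lt_iff₀ hr0]
  rw [div_lt_iff₀ hε] at hr
  linarith [bound r hRr]

/-- **ODE step in the large-sphere volume comparison** (proof of Theorem 2.7).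
If `A, V` are continuously differentiable on `[r₀, ∞)` with
`A' = A/r + 4πr − 8πm + (2/r)(V' − A) + E` and `E → 0` at infinity, then
`V(r) = (1/2) r A(r) − (2π/3) r³ + 2π m r² + o(r²)` as `r → ∞`. -/
theorem volume_from_area_ode
    (m r₀ : ℝ) (hr₀ : 0 < r₀) (A V dA dV E : ℝ → ℝ)
    (hA : ∀ r ∈ Set.Ici r₀, HasDerivAt A (dA r) r)
    (hV : ∀ r ∈ Set.Ici r₀, HasDerivAt V (dV r) r)
    (hdAc : ContinuousOn dA (Set.Ici r₀))
    (hdVc : ContinuousOn dV (Set.Ici r₀))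
    (hrel : ∀ r ∈ Set.Ici r₀,
      dA r = A r / r + 4 * π * r - 8 * π * m + (2 / r) * (dV r - A r) + E r)
    (hE : Tendsto E atTop (𝓝 0)) :
    Tendsto
      (fun r => (V r - ((1/2) * r * A r - (2 * π / 3) * r ^ 3 + 2 * π * m * r ^ 2)) / r ^ 2)
      atTop (𝓝 0) := by
  apply tendsto_div_sq_atTop_of_hasDerivAt (e := fun r => -(1 / 2) * E r)
  · filter_upwards [eventually_ge_atTop r₀] with r hr
    have hr0 : r ≠ 0 := (hr₀.trans_le hr).ne'
    have hrel' := hrel r hr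
    refine ((hV r hr).sub (((((hasDerivAt_id' r).const_mul (1 / 2)).mul (hA r hr)).sub
      ((hasDerivAt_pow 3 r).const_mul (2 * π / 3))).add
      ((hasDerivAt_pow 2 r).const_mul (2 * π * m)))).congr_deriv ?_
    field_simp at hrel'
    push_cast
    linarith
  · simpa only [mul_zero] using hE.const_mul (-(1 / 2))
end

section
/- Let m ∈ ℝ, τ > 1/2, r₀ > 0, and let A, V : [r₀, ∞) → ℝ satisfy A(r) = 4πr²(1 + I(r)) with I(r) = O(r^{−τ}), and V(r) = (1/2) r A(r) − (2π/3) r³ + 2π m r² + o(r²) as r → ∞. Then lim_{r→∞} (2/A(r)) ( V(r) − A(r)^{3/2}/(6√π) ) = m. -/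
open Filter Real Topology

/-- The power `3/2` of the area `4πr²s²`, normalised by `6√π`. -/
lemma rpow_three_halves_div_six_sqrt_pi {r s : ℝ} (hr : 0 ≤ r) (hs : 0 ≤ s) :
    (4 * π * r ^ 2 * s ^ 2) ^ ((3:ℝ)/2) / (6 * Real.sqrt π) = 4 / 3 * π * r ^ 3 * s ^ 3 := by
  have hp : 0 < Real.sqrt π := Real.sqrt_pos.mpr pi_pos
  have hsq : Real.sqrt π ^ 2 = π := Real.sq_sqrt pi_pos.le
  have hbase : 4 * π * r ^ 2 * s ^ 2 = (2 * Real.sqrt π * r * s) ^ (2:ℝ) := by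
    rw [Real.rpow_two]
    linear_combination (-4 * r ^ 2 * s ^ 2) * hsq
  rw [hbase, ← Real.rpow_mul (by positivity), show (2:ℝ) * (3 / 2) = (3:ℕ) by norm_num,
    Real.rpow_natCast, div_eq_iff (by positivity)]
  linear_combination (8 * Real.sqrt π * r ^ 3 * s ^ 3) * hsq

/-- Exact form of the isoperimetric deficit quotient in terms of `s = √(1 + I)`. -/
lemma isoperimetric_quotient_eq {m r s i e : ℝ} (hr : 0 < r) (hs : 0 < s) (hi : s ^ 2 = 1 + i) :
    2 / (4 * π * r ^ 2 * s ^ 2) *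
      ((1/2) * r * (4 * π * r ^ 2 * s ^ 2) - (2 * π / 3) * r ^ 3 + 2 * π * m * r ^ 2 + e
        - (4 * π * r ^ 2 * s ^ 2) ^ ((3:ℝ)/2) / (6 * Real.sqrt π)) =
      m / s ^ 2 + e / r ^ 2 / (2 * π * s ^ 2)
        - r * i ^ 2 * ((2 * s + 1) / (3 * s ^ 2 * (s + 1) ^ 2)) := by
  rw [rpow_three_halves_div_six_sqrt_pi hr.le hs.le]
  obtain rfl : i = s ^ 2 - 1 := by linarith
  have := pi_pos
  field_simp
  ring

/-- A function which is `O(r^{-a})` with `a > 0` tends to zero at infinity. -/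
lemma tendsto_zero_of_abs_le_mul_rpow_neg {f : ℝ → ℝ} {a C r₀ : ℝ} (ha : 0 < a)
    (hf : ∀ r ≥ r₀, |f r| ≤ C * r ^ (-a)) : Tendsto f atTop (𝓝 0) := by
  refine squeeze_zero_norm' ((eventually_ge_atTop r₀).mono hf) ?_
  simpa using (tendsto_rpow_neg_atTop ha).const_mul C

/-- **Analytic step in Miao's proof that the isoperimetric mass equals the ADM mass**
(proof of Corollary 2.9). If `A(r) = 4πr²(1 + I(r))` with `I(r) = O(r^{−τ})`, `τ > 1/2`,
and `V(r) = (1/2) r A(r) − (2π/3) r³ + 2π m r² + o(r²)`, then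
`(2/A(r)) (V(r) − A(r)^{3/2}/(6√π)) → m` as `r → ∞`. -/
theorem isoperimetric_limit_from_expansions
    (m τ r₀ : ℝ) (hτ : 1 / 2 < τ) (hr₀ : 0 < r₀) (A V I : ℝ → ℝ)
    (hA : ∀ r ≥ r₀, A r = 4 * π * r ^ 2 * (1 + I r))
    (hI : ∃ C > 0, ∀ r ≥ r₀, |I r| ≤ C * r ^ (-τ))
    (hV : ∃ e : ℝ → ℝ, Tendsto (fun r => e r / r ^ 2) atTop (𝓝 0) ∧
      ∀ r ≥ r₀, V r = (1/2) * r * A r - (2 * π / 3) * r ^ 3 + 2 * π * m * r ^ 2 + e r) :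
    Tendsto (fun r => (2 / A r) * (V r - (A r) ^ ((3:ℝ)/2) / (6 * Real.sqrt π)))
      atTop (𝓝 m) := by
  obtain ⟨C, -, hC⟩ := hI
  obtain ⟨e, he, hV⟩ := hV
  have hI0 : Tendsto I atTop (𝓝 0) := tendsto_zero_of_abs_le_mul_rpow_neg (by linarith) hC
  have hrI : Tendsto (fun r => r * I r ^ 2) atTop (𝓝 0) := by
    refine tendsto_zero_of_abs_le_mul_rpow_neg (a := 2 * τ - 1) (C := C ^ 2) (r₀ := r₀)
      (by linarith) fun r hr => ?_
    have hr0 : 0 < r := hr₀.trans_le hr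
    calc |r * I r ^ 2| = r * |I r| ^ 2 := by rw [abs_mul, abs_of_pos hr0, abs_pow]
      _ ≤ r * (C * r ^ (-τ)) ^ 2 := by gcongr; exact hC r hr
      _ = C ^ 2 * r ^ (-(2 * τ - 1)) := by
        rw [show -(2 * τ - 1) = 1 + (-τ + -τ) by ring, Real.rpow_add hr0, Real.rpow_add hr0,
          Real.rpow_one]
        ring
  have hs : Tendsto (fun r => Real.sqrt (1 + I r)) atTop (𝓝 1) := by
    simpa using (hI0.const_add 1).sqrt
  have hlim : Tendsto (fun r => m / Real.sqrt (1 + I r) ^ 2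
      + e r / r ^ 2 / (2 * π * Real.sqrt (1 + I r) ^ 2)
      - r * I r ^ 2 * ((2 * Real.sqrt (1 + I r) + 1) /
        (3 * Real.sqrt (1 + I r) ^ 2 * (Real.sqrt (1 + I r) + 1) ^ 2))) atTop (𝓝 m) := by
    have h1 := (tendsto_const_nhds (x := m)).div (hs.pow 2) (by norm_num)
    have h2 := he.div ((hs.pow 2).const_mul (2 * π)) (by positivity)
    have h3 := hrI.mul (((hs.const_mul 2).add_const 1).div
      (((hs.pow 2).const_mul 3).mul ((hs.add_const 1).pow 2)) (by norm_num))
    simpa using (h1.add h2).sub h3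
  refine hlim.congr' ?_
  filter_upwards [eventually_ge_atTop r₀, hI0.eventually (lt_mem_nhds (by norm_num : (-1:ℝ) < 0))]
    with r hr hIr
  have hpos : 0 < 1 + I r := by linarith
  have hsq : Real.sqrt (1 + I r) ^ 2 = 1 + I r := Real.sq_sqrt hpos.le
  rw [← isoperimetric_quotient_eq (hr₀.trans_le hr) (Real.sqrt_pos.mpr hpos) hsq, hsq,
    hV r hr, hA r hr]
end
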